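/- For each mode i ∈ {1, …, N}, let Γ_i be the linear map on real d×d matrices given by Γ_i(X) = Ã₀^{(i)} X (Ã₀^{(i)})ᵀ + Σ_{l=1}^{L} (σ_l^{(i)})² Ã_l^{(i)} X (Ã_l^{(i)})ᵀ, assume for each i there exists a symmetric positive definite P_i with (Ã₀^{(i)})ᵀ P_i Ã₀^{(i)} − P_i + Σ_{l=1}^{L} (σ_l^{(i)})² (Ã_l^{(i)})ᵀ P_i Ã_l^{(i)} negative definite, and let Ŵ₁, …, Ŵ_N be positive semidefinite d×d matrices. Then there exists a positive integer τ_a* such that for every N₀ > 0 and every switching signal σ : ℕ → {1, …, N} having average dwell time τ_a ≥ τ_a* with chatter bound N₀, the switched iteration M(k+1) = Γ_{σ(k)}(M(k)) + Ŵ_{σ(k)} with positive semidefinite M(0) is bounded: sup_k ‖M(k)‖ < ∞. -/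

import Mathlib

open Matrix

/-- `N_σ(s, e)`: the number of switches of `σ` in the interval `(s, e]`, i.e. the number
of indices `k` with `s < k ≤ e` and `σ(k) ≠ σ(k−1)`. -/
def Nswitch {F : Type*} [DecidableEq F] (σ : ℕ → F) (s e : ℕ) : ℕ :=
  ((Finset.Ioc s e).filter fun k => σ k ≠ σ (k - 1)).card

open scoped MatrixOrder in
lemma aux_factor {d : ℕ} {P : Matrix (Fin d) (Fin d) ℝ} (hP : P.PosSemidef) :
    ∃ B : Matrix (Fin d) (Fin d) ℝ, P = Bᴴ * B :=
  CStarAlgebra.nonneg_iff_eq_star_mul_self.mp hP.nonneg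

lemma aux_entry {d : ℕ} {X : Matrix (Fin d) (Fin d) ℝ} (hX : X.PosSemidef) (i j : Fin d) :
    |X i j| ≤ X.trace := by
  have hdiag : ∀ k, 0 ≤ X k k := fun k => hX.diag_nonneg
  have hle : ∀ k, X k k ≤ X.trace := fun k => by
    unfold Matrix.trace
    exact Finset.single_le_sum (f := fun k => X.diag k) (fun k _ => hdiag k) (Finset.mem_univ k)
  have hsym : X j i = X i j := by
    have := hX.isHermitian.apply i j
    simpa using this
  have h1 := hX.dotProduct_mulVec_nonneg (Pi.single i 1 + Pi.single j 1)
  have h2 := hX.dotProduct_mulVec_nonneg (Pi.single i 1 - Pi.single j 1)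
  simp [Matrix.mulVec_add, Matrix.mulVec_sub, add_dotProduct, sub_dotProduct, dotProduct_add,
    dotProduct_sub, hsym] at h1 h2
  have hi := hle i
  have hj := hle j
  rw [abs_le]
  constructor <;> linarith

lemma aux_trace_upper {d : ℕ} (Q : Matrix (Fin d) (Fin d) ℝ) :
    ∃ K : ℝ, 0 ≤ K ∧ ∀ X : Matrix (Fin d) (Fin d) ℝ, X.PosSemidef →
      (Q * X).trace ≤ K * X.trace := by
  refine ⟨∑ i, ∑ j, |Q i j|, by positivity, fun X hX => ?_⟩
  simp only [Matrix.trace, Matrix.diag, Matrix.mul_apply, Finset.sum_mul]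
  refine Finset.sum_le_sum fun i _ => Finset.sum_le_sum fun j _ => ?_
  calc Q i j * X j i ≤ |Q i j| * |X j i| := by rw [← abs_mul]; exact le_abs_self _
    _ ≤ _ := mul_le_mul_of_nonneg_left (aux_entry hX j i) (abs_nonneg _)

lemma aux_trace_lower {d : ℕ} {P : Matrix (Fin d) (Fin d) ℝ} (hP : P.PosDef) :
    ∃ K : ℝ, 0 ≤ K ∧ ∀ X : Matrix (Fin d) (Fin d) ℝ, X.PosSemidef →
      X.trace ≤ K * (P * X).trace := by
  obtain ⟨B, hB⟩ := aux_factor hP.posSemidef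
  have hdet : IsUnit B.det := by
    have h := hP.det_pos
    rw [hB, Matrix.det_mul] at h
    rw [isUnit_iff_ne_zero]
    rintro h0
    simp [h0] at h
  obtain ⟨K, hK, h⟩ := aux_trace_upper ((B⁻¹)ᵀ * B⁻¹)
  refine ⟨K, hK, fun X hX => ?_⟩
  have hY := hX.mul_mul_conjTranspose_same B
  have h1 := h _ hY
  rw [conjTranspose_eq_transpose_of_trivial] at h1 hB
  have e1 : (((B⁻¹)ᵀ * B⁻¹) * (B * X * Bᵀ)).trace = X.trace := by
    have : ((B⁻¹)ᵀ * B⁻¹) * (B * X * Bᵀ) = (B⁻¹)ᵀ * ((B⁻¹ * B) * X * Bᵀ) := by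
      simp only [Matrix.mul_assoc]
    rw [this, Matrix.nonsing_inv_mul _ hdet, Matrix.one_mul, Matrix.trace_mul_comm,
      Matrix.mul_assoc, ← Matrix.transpose_mul, Matrix.nonsing_inv_mul _ hdet]
    simp
  have e2 : (B * X * Bᵀ).trace = (P * X).trace := by
    rw [Matrix.trace_mul_comm, hB, Matrix.mul_assoc]
  rwa [e1, e2] at h1

lemma aux_trace_nonneg {d : ℕ} {P : Matrix (Fin d) (Fin d) ℝ} (hP : P.PosDef)
    {X : Matrix (Fin d) (Fin d) ℝ} (hX : X.PosSemidef) : 0 ≤ (P * X).trace := by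
  obtain ⟨B, hB⟩ := aux_factor hP.posSemidef
  have hY := hX.mul_mul_conjTranspose_same B
  have : (P * X).trace = (B * X * Bᴴ).trace := by
    rw [Matrix.trace_mul_comm (B * X), hB, Matrix.mul_assoc]
  rw [this]
  exact hY.trace_nonneg

lemma aux_trace_compare {d : ℕ} {P : Matrix (Fin d) (Fin d) ℝ} (hP : P.PosDef)
    (Q : Matrix (Fin d) (Fin d) ℝ) :
    ∃ K : ℝ, 0 ≤ K ∧ ∀ X : Matrix (Fin d) (Fin d) ℝ, X.PosSemidef →
      (Q * X).trace ≤ K * (P * X).trace := by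
  obtain ⟨K1, hK1, h1⟩ := aux_trace_upper Q
  obtain ⟨K2, hK2, h2⟩ := aux_trace_lower hP
  refine ⟨K1 * K2, by positivity, fun X hX => (h1 X hX).trans ?_⟩
  rw [mul_assoc]
  exact mul_le_mul_of_nonneg_left (h2 X hX) hK1

lemma aux_Nswitch_succ {F : Type*} [DecidableEq F] (σ : ℕ → F) (s e : ℕ) (h : s ≤ e) :
    (Nswitch σ s (e + 1) : ℝ) = Nswitch σ s e + if σ (e + 1) ≠ σ e then 1 else 0 := by
  unfold Nswitch
  have : Finset.Ioc s (e + 1) = insert (e + 1) (Finset.Ioc s e) := by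
    ext x; simp only [Finset.mem_Ioc, Finset.mem_insert]; omega
  rw [this, Finset.filter_insert]
  by_cases hc : σ (e + 1) ≠ σ e
  · rw [if_pos (by simpa using hc), Finset.card_insert_of_notMem (by simp), if_pos hc]
    push_cast; ring
  · rw [if_neg (by simpa using hc), if_neg hc]; simp

/-- Running excess of the number of switches over the average dwell time budget. -/
noncomputable def auxZ {F : Type*} [DecidableEq F] (σ : ℕ → F) (τ : ℝ) : ℕ → ℝ
  | 0 => 0
  | k + 1 => max 0 (auxZ σ τ k + (if σ (k + 1) ≠ σ k then 1 else 0) - 1 / τ)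

lemma auxZ_eq {F : Type*} [DecidableEq F] (σ : ℕ → F) (τ : ℝ) (k : ℕ) :
    ∃ j ≤ k, auxZ σ τ k = Nswitch σ j k - ((k : ℝ) - j) / τ := by
  induction k with
  | zero => exact ⟨0, le_rfl, by simp [auxZ, Nswitch]⟩
  | succ k ih =>
    obtain ⟨j, hj, hz⟩ := ih
    rcases max_choice 0 (auxZ σ τ k + (if σ (k + 1) ≠ σ k then 1 else 0) - 1 / τ) with h | h
    · refine ⟨k + 1, le_rfl, ?_⟩
      rw [auxZ, h]; simp [Nswitch]
    · refine ⟨j, by omega, ?_⟩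
      rw [auxZ, h, aux_Nswitch_succ σ j k hj, hz]
      push_cast; ring

lemma auxZ_nonneg {F : Type*} [DecidableEq F] (σ : ℕ → F) (τ : ℝ) (k : ℕ) :
    0 ≤ auxZ σ τ k := by
  cases k with
  | zero => simp [auxZ]
  | succ k => rw [auxZ]; exact le_max_left _ _

lemma aux_scalar {F : Type*} [DecidableEq F] (σ : ℕ → F) (τ N₀ m a w : ℝ) (hm : 0 ≤ m)
    (ha : 0 < a) (hw : 0 ≤ w) (hτ : m / τ ≤ a)
    (hN : ∀ s e : ℕ, s ≤ e → (Nswitch σ s e : ℝ) ≤ N₀ + ((e : ℝ) - (s : ℝ)) / τ)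
    (y : ℕ → ℝ) (hy0 : ∀ k, 0 ≤ y k)
    (hy : ∀ k, y (k + 1) ≤
      Real.exp (m * if σ (k + 1) ≠ σ k then 1 else 0) * (Real.exp (-(2 * a)) * y k + w)) :
    ∃ C : ℝ, ∀ k, y k ≤ C := by
  set z := auxZ σ τ with hzdef
  have hzN : ∀ k, z k ≤ N₀ := fun k => by
    obtain ⟨j, hj, h⟩ := auxZ_eq σ τ k
    have := hN j k hj
    rw [hzdef, h]; linarith
  have hz0 : ∀ k, 0 ≤ z k := auxZ_nonneg σ τ
  have hstep : ∀ k, y (k + 1) * Real.exp (-(m * z (k + 1))) ≤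
      Real.exp (-a) * (y k * Real.exp (-(m * z k))) + Real.exp a * w := fun k => by
    have hz1 : z k + (if σ (k + 1) ≠ σ k then 1 else 0) - 1 / τ ≤ z (k + 1) := by
      rw [hzdef, auxZ]; exact le_max_right _ _
    set s : ℝ := if σ (k + 1) ≠ σ k then 1 else 0 with hs
    have hb : 0 ≤ Real.exp (-(2 * a)) * y k + w := by
      have := hy0 k; positivity
    have hexp : m * s - m * z (k + 1) ≤ a - m * z k := by
      have h1 := mul_le_mul_of_nonneg_left hz1 hm
      have h2 : m * (z k + s - 1 / τ) = m * z k + m * s - m / τ := by ring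
      linarith
    have hmz : 0 ≤ m * z k := mul_nonneg hm (hz0 k)
    calc y (k + 1) * Real.exp (-(m * z (k + 1)))
        ≤ (Real.exp (m * s) * (Real.exp (-(2 * a)) * y k + w)) * Real.exp (-(m * z (k + 1))) :=
          mul_le_mul_of_nonneg_right (hy k) (Real.exp_pos _).le
      _ = Real.exp (m * s - m * z (k + 1)) * (Real.exp (-(2 * a)) * y k + w) := by
          rw [sub_eq_add_neg, Real.exp_add]; ring
      _ ≤ Real.exp (a - m * z k) * (Real.exp (-(2 * a)) * y k + w) :=
          mul_le_mul_of_nonneg_right (Real.exp_le_exp.2 hexp) hb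
      _ = Real.exp (-a) * (y k * Real.exp (-(m * z k))) + Real.exp (a - m * z k) * w := by
          have e : Real.exp (a - m * z k) * Real.exp (-(2 * a))
              = Real.exp (-a) * Real.exp (-(m * z k)) := by
            rw [← Real.exp_add, ← Real.exp_add]; congr 1; ring
          linear_combination y k * e
      _ ≤ _ := by
          have : Real.exp (a - m * z k) ≤ Real.exp a := Real.exp_le_exp.2 (by linarith)
          have := mul_le_mul_of_nonneg_right this hw
          linarith
  have hq1 : Real.exp (-a) < 1 := by rw [← Real.exp_zero]; exact Real.exp_lt_exp.2 (by linarith)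
  have hq0 := Real.exp_pos (-a)
  set q := Real.exp (-a)
  set c := Real.exp a * w
  have hc : 0 ≤ c := by positivity
  have hd : 0 < 1 - q := by linarith
  have hB : ∀ k, y k * Real.exp (-(m * z k)) ≤ y 0 + c / (1 - q) := fun k => by
    induction k with
    | zero =>
      have : z 0 = 0 := rfl
      have h2 : 0 ≤ c / (1 - q) := by positivity
      simp [this]; exact h2
    | succ k ih =>
      have h1 := mul_le_mul_of_nonneg_left ih hq0.le
      have h2 : q * (c / (1 - q)) + c = c / (1 - q) := by field_simp; ring
      have h3 : q * y 0 ≤ y 0 := by nlinarith [hy0 0]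
      have := hstep k
      linarith
  refine ⟨(y 0 + c / (1 - q)) * Real.exp (m * N₀), fun k => ?_⟩
  have e : y k = (y k * Real.exp (-(m * z k))) * Real.exp (m * z k) := by
    rw [mul_assoc, ← Real.exp_add]; simp
  have hnn : 0 ≤ y 0 + c / (1 - q) := by have := hy0 0; positivity
  rw [e]
  exact mul_le_mul (hB k) (Real.exp_le_exp.2 (mul_le_mul_of_nonneg_left (hzN k) hm))
    (Real.exp_pos _).le hnn

/-- If every mode `i` of the noisy switched state-correlation dynamics
`M(k+1) = Γ_{σ(k)}(M(k)) + Ŵ_{σ(k)}`, with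
`Γ_i(X) = Ã₀⁽ⁱ⁾ X (Ã₀⁽ⁱ⁾)ᵀ + Σ_l (σ_l⁽ⁱ⁾)² Ã_l⁽ⁱ⁾ X (Ã_l⁽ⁱ⁾)ᵀ` and positive
semidefinite `Ŵ_i`, satisfies the mean-square-stability LMI, then there is a positive
integer `τ_a*` such that for every chatter bound `N₀ > 0` and every switching signal with
average dwell time `τ_a ≥ τ_a*`, the iteration started at a positive semidefinite matrix
is bounded. -/
theorem stmt15 {d N L : ℕ}
    (A0 : Fin N → Matrix (Fin d) (Fin d) ℝ)
    (Amat : Fin N → Fin L → Matrix (Fin d) (Fin d) ℝ)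
    (σ2 : Fin N → Fin L → ℝ) (hσ2 : ∀ i l, 0 ≤ σ2 i l)
    (What : Fin N → Matrix (Fin d) (Fin d) ℝ) (hWhat : ∀ i, (What i).PosSemidef)
    (hLMI : ∀ i, ∃ P : Matrix (Fin d) (Fin d) ℝ, P.PosDef ∧
      (-((A0 i)ᵀ * P * A0 i - P + ∑ l, σ2 i l • ((Amat i l)ᵀ * P * Amat i l))).PosDef) :
    ∃ τstar : ℕ, 0 < τstar ∧
      ∀ N₀ : ℝ, 0 < N₀ → ∀ τa : ℝ, (τstar : ℝ) ≤ τa →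
        ∀ σ : ℕ → Fin N,
          (∀ s e : ℕ, s ≤ e → (Nswitch σ s e : ℝ) ≤ N₀ + ((e : ℝ) - (s : ℝ)) / τa) →
          ∀ M : ℕ → Matrix (Fin d) (Fin d) ℝ, (M 0).PosSemidef →
            (∀ k, M (k + 1) =
              A0 (σ k) * M k * (A0 (σ k))ᵀ
                + ∑ l, σ2 (σ k) l • (Amat (σ k) l * M k * (Amat (σ k) l)ᵀ)
                + What (σ k)) →
            ∃ C : ℝ, ∀ k (i j : Fin d), |M k i j| ≤ C := by
  classical
  choose P hP hQ using hLMI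
  set Q : Fin N → Matrix (Fin d) (Fin d) ℝ := fun i =>
    -((A0 i)ᵀ * P i * A0 i - P i + ∑ l, σ2 i l • ((Amat i l)ᵀ * P i * Amat i l)) with hQdef
  choose K1 hK1 h1 using fun i => aux_trace_compare (hQ i) (P i)
  choose K2 hK2 h2 using fun i j => aux_trace_compare (hP i) (P j)
  choose K3 hK3 h3 using fun i => aux_trace_lower (hP i)
  set K : ℝ := 2 + ∑ i, K1 i + ∑ i, ∑ j, K2 i j + ∑ i, K3 i with hK
  have hs1 : 0 ≤ ∑ i, K1 i := Finset.sum_nonneg fun i _ => hK1 i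
  have hs2 : 0 ≤ ∑ i, ∑ j, K2 i j :=
    Finset.sum_nonneg fun i _ => Finset.sum_nonneg fun j _ => hK2 i j
  have hs3 : 0 ≤ ∑ i, K3 i := Finset.sum_nonneg fun i _ => hK3 i
  have hKpos : 0 < K := by linarith
  have hle1 : ∀ i, K1 i ≤ K := fun i => by
    have := Finset.single_le_sum (f := K1) (fun i _ => hK1 i) (Finset.mem_univ i)
    linarith
  have hle3 : ∀ i, K3 i ≤ K := fun i => by
    have := Finset.single_le_sum (f := K3) (fun i _ => hK3 i) (Finset.mem_univ i)
    linarith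
  have hle2 : ∀ i j, K2 i j ≤ K := fun i j => by
    have ha := Finset.single_le_sum (f := fun j => K2 i j) (fun j _ => hK2 i j) (Finset.mem_univ j)
    have hb := Finset.single_le_sum (f := fun i => ∑ j, K2 i j)
      (fun i _ => Finset.sum_nonneg fun j _ => hK2 i j) (Finset.mem_univ i)
    linarith
  set w : ℝ := ∑ i, |(P i * What i).trace| with hwdef
  have hw : 0 ≤ w := Finset.sum_nonneg fun i _ => abs_nonneg _
  have hwle : ∀ i, (P i * What i).trace ≤ w := fun i =>
    (le_abs_self _).trans (Finset.single_le_sum (f := fun i => |(P i * What i).trace|)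
      (fun i _ => abs_nonneg _) (Finset.mem_univ i))
  refine ⟨⌈2 * K * K⌉₊ + 1, Nat.succ_pos _, ?_⟩
  intro N₀ _ τa hτ σ hN M hM0 hM
  have hτ' : 2 * K * K ≤ τa := by
    have := Nat.le_ceil (2 * K * K)
    push_cast at hτ
    linarith
  have hτpos : 0 < τa := lt_of_lt_of_le (by positivity) hτ'
  have hpsd : ∀ k, (M k).PosSemidef := fun k => by
    induction k with
    | zero => exact hM0
    | succ k ih =>
      rw [hM k]
      have hA : ∀ A : Matrix (Fin d) (Fin d) ℝ, (A * M k * Aᵀ).PosSemidef := fun A => by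
        have := ih.mul_mul_conjTranspose_same A
        rwa [conjTranspose_eq_transpose_of_trivial] at this
      refine ((hA _).add ?_).add (hWhat _)
      exact Matrix.posSemidef_sum _ fun l _ => (hA _).smul (hσ2 _ _)
  have hdec : ∀ k, (P (σ k) * M (k + 1)).trace ≤
      Real.exp (-(2 * (1 / (2 * K)))) * (P (σ k) * M k).trace + w := fun k => by
    set i := σ k
    have htr : ∀ A : Matrix (Fin d) (Fin d) ℝ,
        (P i * (A * M k * Aᵀ)).trace = (Aᵀ * P i * A * M k).trace := fun A => by
      rw [Matrix.trace_mul_comm, Matrix.mul_assoc (A * M k), Matrix.trace_mul_comm (A * M k)]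
      simp only [Matrix.mul_assoc]
    have e : (P i * M (k + 1)).trace =
        (P i * M k).trace - (Q i * M k).trace + (P i * What i).trace := by
      rw [hM k, Matrix.mul_add, Matrix.mul_add, Matrix.trace_add, Matrix.trace_add, htr]
      simp only [hQdef, Matrix.neg_mul, Matrix.add_mul, Matrix.sub_mul, Matrix.trace_neg,
        Matrix.trace_add, Matrix.trace_sub, Matrix.mul_sum, Matrix.sum_mul, Matrix.trace_sum,
        Matrix.mul_smul, Matrix.smul_mul, Matrix.trace_smul]
      have : ∀ l, (P i * (Amat i l * M k * (Amat i l)ᵀ)).trace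
        = ((Amat i l)ᵀ * P i * Amat i l * M k).trace := fun l => htr _
      simp only [i] at this ⊢
      simp only [this]
      ring
    have hq := aux_trace_nonneg (hQ i) (hpsd k)
    have hp := aux_trace_nonneg (hP i) (hpsd k)
    have hpq : (P i * M k).trace ≤ K * (Q i * M k).trace :=
      (h1 i _ (hpsd k)).trans (mul_le_mul_of_nonneg_right (hle1 i) hq)
    have hpq' : (P i * M k).trace / K ≤ (Q i * M k).trace := by
      rw [div_le_iff₀ hKpos]; linarith
    have hexp : 1 - 1 / K ≤ Real.exp (-(2 * (1 / (2 * K)))) := by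
      have := Real.add_one_le_exp (-(2 * (1 / (2 * K))))
      have e2 : -(2 * (1 / (2 * K))) = - (1 / K) := by field_simp
      rw [e2] at this ⊢
      linarith
    have := mul_le_mul_of_nonneg_right hexp hp
    have e3 : (1 - 1 / K) * (P i * M k).trace = (P i * M k).trace - (P i * M k).trace / K := by
      ring
    have := hwle i
    linarith
  have hKexp : K ≤ Real.exp K := by have := Real.add_one_le_exp K; linarith
  obtain ⟨C, hC⟩ := aux_scalar σ τa N₀ K (1 / (2 * K)) w hKpos.le (by positivity) hw
    (by rw [div_le_div_iff₀ hτpos (by positivity)]; linarith) hN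
    (fun k => (P (σ k) * M k).trace) (fun k => aux_trace_nonneg (hP _) (hpsd k)) (fun k => by
      have hd := hdec k
      have hp := aux_trace_nonneg (hP (σ k)) (hpsd (k + 1))
      by_cases hc : σ (k + 1) ≠ σ k
      · rw [if_pos hc, mul_one]
        calc (P (σ (k + 1)) * M (k + 1)).trace
            ≤ K2 (σ k) (σ (k + 1)) * (P (σ k) * M (k + 1)).trace := h2 _ _ _ (hpsd _)
          _ ≤ Real.exp K * (P (σ k) * M (k + 1)).trace :=
            mul_le_mul_of_nonneg_right ((hle2 _ _).trans hKexp) hp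
          _ ≤ _ := mul_le_mul_of_nonneg_left hd (Real.exp_pos _).le
      · rw [if_neg hc]
        push Not at hc
        simp only [hc, mul_zero, Real.exp_zero, one_mul]
        exact hd)
  refine ⟨K * C, fun k i j => (aux_entry (hpsd k) i j).trans ((h3 (σ k) _ (hpsd k)).trans ?_)⟩
  exact mul_le_mul (hle3 _) (hC k) (aux_trace_nonneg (hP _) (hpsd k)) hKpos.le
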